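/- Let g ∈ ℤ[x] be x²-divisible of degree d and let c ∈ ℚ. Then for every n ≥ 0 one has ln B_n ≤ d^n ln B_0; equivalently B_n divides B_0^{d^n}, in particular B_n ≤ B_0^{d^n}. -/

import Mathlib

open Polynomial

/-- The `n`-th iterate of `g_c := g + c` applied to `0`, for `g ∈ ℤ[x]` and `c ∈ ℚ`. -/
noncomputable def gcIter (g : ℤ[X]) (c : ℚ) (n : ℕ) : ℚ :=
  (fun x : ℚ => (g.map (Int.castRingHom ℚ)).eval x + c)^[n] 0

/-- `g` is `x²`-divisible: degree at least 2 and zero constant and linear coefficients. -/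
def IsX2Divisible (g : ℤ[X]) : Prop :=
  2 ≤ g.natDegree ∧ g.coeff 0 = 0 ∧ g.coeff 1 = 0

/-- The length `L_g = 1 + ∑_{i=2}^{d-1} |u_i|/|u_d|` of an `x²`-divisible polynomial. -/
noncomputable def Lg (g : ℤ[X]) : ℝ :=
  1 + ∑ i ∈ Finset.Ico 2 g.natDegree, (|g.coeff i| : ℝ) / (|g.leadingCoeff| : ℝ)

/-- `S_g`: the set of `c ∈ ℚ` such that the sequence `{g_c^n(0)}_{n ≥ 1}` takes
infinitely many values. -/
def Sg (g : ℤ[X]) : Set ℚ :=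
  {c : ℚ | (Set.range fun n : ℕ => gcIter g c (n + 1)).Infinite}

/-- The numerator `A_n` of `g_c^{n+1}(0) = g_c^n(c) = A_n / B_n` in lowest terms. -/
noncomputable def An (g : ℤ[X]) (c : ℚ) (n : ℕ) : ℤ := (gcIter g c (n + 1)).num

/-- The (positive) denominator `B_n` of `g_c^{n+1}(0) = g_c^n(c) = A_n / B_n`
in lowest terms. -/
noncomputable def Bn (g : ℤ[X]) (c : ℚ) (n : ℕ) : ℕ := (gcIter g c (n + 1)).den

/-- For a natural number `a`, the factor `â = ∏_{p ∈ I(a)} p^{val_p(a)}`, where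
`I(a)` consists of the primes `p` with `val_p(a) > val_p(u_d)`. -/
noncomputable def hatB (g : ℤ[X]) (a : ℕ) : ℕ :=
  ∏ p ∈ a.primeFactors.filter
      (fun p => padicValInt p g.leadingCoeff < padicValNat p a),
    p ^ padicValNat p a

/-- `g` has rapidly increasing numerators on `S`: there is an integer `N > 0` such that
for every `c ∈ S` there is a finite set `J_c ⊆ ℕ` with `#J_c ≤ N` such that for every
`n ≥ 1` outside `J_c` one has `ln |A_n| > ∑_{p ∣ n} ln |A_{n/p}|`. -/
def RapidlyIncreasingNumerators (g : ℤ[X]) (S : Set ℚ) : Prop :=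
  ∃ N : ℕ, 0 < N ∧ ∀ c ∈ S, ∃ J : Finset ℕ, J.card ≤ N ∧
    ∀ n : ℕ, 1 ≤ n → n ∉ J →
      (∑ p ∈ n.primeFactors, Real.log |(An g c (n / p) : ℝ)|) <
        Real.log |(An g c n : ℝ)|

theorem Rat.den_eval_map_intCast_dvd_pow (g : ℤ[X]) (x : ℚ) :
    ((g.map (Int.castRingHom ℚ)).eval x).den ∣ x.den ^ g.natDegree := by
  rw [eval_map, eval₂_eq_sum_range]
  refine Finset.sum_induction _ (fun q : ℚ => q.den ∣ x.den ^ g.natDegree)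
    (fun a b ha hb => (Rat.add_den_dvd_lcm a b).trans (Nat.lcm_dvd ha hb)) (by simp) ?_
  intro i hi
  refine (Rat.mul_den_dvd _ _).trans ?_
  rw [eq_intCast, Rat.den_intCast, one_mul, Rat.den_pow]
  exact pow_dvd_pow _ (Finset.mem_range_succ_iff.mp hi)

theorem gcIter_succ (g : ℤ[X]) (c : ℚ) (n : ℕ) :
    gcIter g c (n + 1) = (g.map (Int.castRingHom ℚ)).eval (gcIter g c n) + c :=
  Function.iterate_succ_apply' _ _ _

theorem Bn_zero (g : ℤ[X]) (h : g.coeff 0 = 0) (c : ℚ) : Bn g c 0 = c.den := by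
  simp [Bn, gcIter, ← coeff_zero_eq_eval_zero, h]

theorem Bn_succ_dvd (g : ℤ[X]) (h : g.coeff 0 = 0) (c : ℚ) (n : ℕ) :
    Bn g c (n + 1) ∣ (Bn g c n ^ g.natDegree).lcm (Bn g c 0) := by
  rw [Bn_zero g h, Bn, gcIter_succ]
  exact (Rat.add_den_dvd_lcm _ _).trans
    (Nat.lcm_dvd ((Rat.den_eval_map_intCast_dvd_pow g _).trans (Nat.dvd_lcm_left _ _))
      (Nat.dvd_lcm_right _ _))

theorem Bn_dvd_Bn_zero_pow (g : ℤ[X]) (hd : g.natDegree ≠ 0) (h : g.coeff 0 = 0) (c : ℚ)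
    (n : ℕ) : Bn g c n ∣ Bn g c 0 ^ (g.natDegree ^ n) := by
  induction n with
  | zero => simp
  | succ n ih =>
    refine (Bn_succ_dvd g h c n).trans (Nat.lcm_dvd ?_ ?_)
    · rw [pow_succ, pow_mul]
      exact pow_dvd_pow_of_dvd ih _
    · exact dvd_pow_self _ (pow_ne_zero _ hd)

/-- Lemma 2.8(1): `B_n` divides `B_0^{d^n}`; in particular `ln B_n ≤ d^n · ln B_0`. -/
theorem Bn_dvd_pow (g : ℤ[X]) (hg : IsX2Divisible g) (c : ℚ) (n : ℕ) :
    Bn g c n ∣ Bn g c 0 ^ (g.natDegree ^ n) ∧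
    Real.log (Bn g c n) ≤ (g.natDegree : ℝ) ^ n * Real.log (Bn g c 0) := by
  have h := Bn_dvd_Bn_zero_pow g (by have := hg.1; lia) hg.2.1 c n
  refine ⟨h, ?_⟩
  have h_le := Nat.le_of_dvd (pow_pos (Rat.den_pos _) _) h
  calc Real.log (Bn g c n)
      ≤ Real.log ((Bn g c 0 : ℝ) ^ (g.natDegree ^ n)) :=
        Real.log_le_log (Nat.cast_pos.mpr (Rat.den_pos _)) (mod_cast h_le)
    _ = (g.natDegree : ℝ) ^ n * Real.log (Bn g c 0) := by
        rw [Real.log_pow, Nat.cast_pow]
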